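/- There exist r > 0 and C > 0, depending only on f, such that for all s with |s| ≤ 2r and all y ∈ B_r(0), writing x = (s, f(s)), the tangential component of the reflection displacement satisfies |(y*₁(y) − y₁) + f'(s)(y*₂(y) − y₂)| ≤ C|x − y|². -/

import Mathlib

open Real

noncomputable section

/-- The point `(a, b)` of the Euclidean plane. -/
def pt (a b : ℝ) : EuclideanSpace ℝ (Fin 2) := (WithLp.equiv 2 (Fin 2 → ℝ)).symm ![a, b]

theorem pt_apply_zero (a b : ℝ) : pt a b 0 = a := by simp [pt]

theorem pt_apply_one (a b : ℝ) : pt a b 1 = b := by simp [pt]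

theorem continuous_pt_graph {f : ℝ → ℝ} (hf : Continuous f) :
    Continuous fun s => pt s (f s) := by
  refine (PiLp.continuous_toLp 2 _).comp (continuous_pi fun i => ?_)
  fin_cases i
  · exact continuous_id
  · exact hf

/-- **Tangential component of the reflection displacement.**
With `f`, the implicit map `S` of Lemma 1 (on a ball of radius `r₀`) and the
reflection `y*(y) = 2 (S y, f (S y)) − y`: there exist `r > 0` and `C > 0`,
depending only on `f`, such that for all `s` with `|s| ≤ 2r` and all
`y ∈ B_r(0)`, writing `x = (s, f s)`,
`|(y*₁(y) − y₁) + f'(s) (y*₂(y) − y₂)| ≤ C |x − y|²`. -/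
theorem reflection_tangential_component_bound
    (f : ℝ → ℝ) (hf : ContDiff ℝ 3 f) (hf0 : f 0 = 0) (hf'0 : deriv f 0 = 0)
    (r₀ : ℝ) (hr₀ : 0 < r₀) (S : EuclideanSpace ℝ (Fin 2) → ℝ)
    (hS : ∀ y ∈ Metric.ball (0 : EuclideanSpace ℝ (Fin 2)) r₀,
        S y ∈ Set.Ioo (-(2 * r₀)) (2 * r₀) ∧
        (S y - y 0) + deriv f (S y) * (f (S y) - y 1) = 0 ∧
        ∀ s ∈ Set.Ioo (-(2 * r₀)) (2 * r₀),
          (s - y 0) + deriv f s * (f s - y 1) = 0 → s = S y)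
    (hS2 : ContDiffOn ℝ 2 S (Metric.ball 0 r₀))
    (ystar : EuclideanSpace ℝ (Fin 2) → EuclideanSpace ℝ (Fin 2))
    (hystar : ∀ y, ystar y = (2 : ℝ) • pt (S y) (f (S y)) - y) :
    ∃ r C : ℝ, 0 < r ∧ r ≤ r₀ ∧ 0 < C ∧
      ∀ s : ℝ, |s| ≤ 2 * r →
        ∀ y ∈ Metric.ball (0 : EuclideanSpace ℝ (Fin 2)) r,
          |(ystar y 0 - y 0) + deriv f s * (ystar y 1 - y 1)|
            ≤ C * ‖pt s (f s) - y‖ ^ 2 := by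
  have hpt0 : pt 0 (f 0) = 0 := by
    ext i; fin_cases i <;> simp [pt, hf0]
  have hball0 : Metric.ball (0 : EuclideanSpace ℝ (Fin 2)) r₀ ∈ nhds 0 :=
    Metric.ball_mem_nhds _ hr₀
  have hS0 : S 0 = 0 :=
    ((hS 0 (Metric.mem_ball_self hr₀)).2.2 0 ⟨by linarith, by linarith⟩ (by simp [hf'0])).symm
  have hSat : ContDiffAt ℝ 2 S 0 := hS2.contDiffAt hball0
  have hf' : ContDiff ℝ 1 (deriv f) :=
    (contDiff_succ_iff_deriv.1
      (hf.of_le (by norm_num) : ContDiff ℝ (1 + 1) f)).2.2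
  obtain ⟨K, T, hT, hK⟩ :=
    (hSat.of_le (by norm_num : (1 : WithTop ℕ∞) ≤ 2)).exists_lipschitzOnWith
  obtain ⟨L, U, hU, hL⟩ :=
    (hf.contDiffAt.of_le (by norm_num : (1 : WithTop ℕ∞) ≤ 3) :
      ContDiffAt ℝ 1 f 0).exists_lipschitzOnWith
  obtain ⟨M, V, hV, hM⟩ := (hf'.contDiffAt (x := 0)).exists_lipschitzOnWith
  have hSt : Filter.Tendsto S (nhds 0) (nhds 0) := by
    simpa [ContinuousAt, hS0] using hSat.continuousAt
  have hpt : Filter.Tendsto (fun s => pt s (f s)) (nhds 0) (nhds 0) := by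
    simpa only [hpt0] using (continuous_pt_graph hf.continuous).tendsto 0
  obtain ⟨d₁, hd₁, h₁⟩ := Metric.eventually_nhds_iff.1
    (((Filter.eventually_mem_set.2 hT).and (hSt.eventually_mem hU)).and (hSt.eventually_mem hV))
  obtain ⟨d₂, hd₂, h₂⟩ := Metric.eventually_nhds_iff.1
    (((Filter.eventually_mem_set.2 hU).and (Filter.eventually_mem_set.2 hV)).and
      ((hpt.eventually_mem hT).and ((hpt.eventually_mem hball0).and
        (Filter.eventually_mem_set.2 (Ioo_mem_nhds (by linarith : -(2 * r₀) < 0)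
          (by linarith : 0 < 2 * r₀))))))
  refine ⟨min r₀ (min d₁ (d₂ / 4)), 2 * (M * K) * (L * K + 1) + 1, by positivity,
    min_le_left _ _, by positivity, fun s hs y hy => ?_⟩
  rw [Metric.mem_ball, lt_min_iff, lt_min_iff] at hy
  obtain ⟨hyr, hyd, -⟩ := hy
  obtain ⟨⟨hyT, hyU⟩, hyV⟩ := h₁ hyd
  have hsd : dist s 0 < d₂ := by
    rw [Real.dist_eq, sub_zero]
    have := (min_le_right r₀ (min d₁ (d₂ / 4))).trans (min_le_right _ _)
    linarith
  obtain ⟨⟨hsU, hsV⟩, hxT, hxb, hsI⟩ := h₂ hsd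
  have hSx : s = S (pt s (f s)) :=
    (hS _ hxb).2.2 s hsI (by rw [pt_apply_zero, pt_apply_one]; ring)
  have heq := (hS y hyr).2.1
  set t := S y with ht
  set D := ‖pt s (f s) - y‖ with hD
  have hst : |s - t| ≤ K * D := by
    have h := hK.dist_le_mul _ hxT _ hyT
    rwa [← hSx, Real.dist_eq, dist_eq_norm] at h
  have hfst : |f s - f t| ≤ L * |s - t| := by
    simpa only [Real.dist_eq] using hL.dist_le_mul _ hsU _ hyU
  have hf'st : |deriv f s - deriv f t| ≤ M * |s - t| := by
    simpa only [Real.dist_eq] using hM.dist_le_mul _ hsV _ hyV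
  have hfy : |f s - y 1| ≤ D := by
    have h := PiLp.norm_apply_le (pt s (f s) - y) 1
    rwa [PiLp.sub_apply, pt_apply_one, Real.norm_eq_abs] at h
  have hA : |deriv f s - deriv f t| ≤ M * K * D := by
    rw [mul_assoc]
    exact hf'st.trans (by gcongr)
  have hB : |f t - y 1| ≤ (L * K + 1) * D := by
    have h := abs_sub_le (f t) (f s) (y 1)
    rw [abs_sub_comm (f t) (f s)] at h
    have h' : (L : ℝ) * |s - t| ≤ L * (K * D) := by gcongr
    linarith
  have hexp : (ystar y 0 - y 0) + deriv f s * (ystar y 1 - y 1)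
      = 2 * ((deriv f s - deriv f t) * (f t - y 1)) := by
    simp only [hystar, PiLp.sub_apply, PiLp.smul_apply, smul_eq_mul, pt_apply_zero, pt_apply_one,
      ← ht]
    linear_combination 2 * heq
  rw [hexp, abs_mul, abs_mul, abs_two]
  have hAB : |deriv f s - deriv f t| * |f t - y 1| ≤ M * K * D * ((L * K + 1) * D) := by
    gcongr
  nlinarith [sq_nonneg D]
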